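/- arXiv:1607.05002 — 2 statements merged into one kernel-verified Lean document; each statement's English description precedes it below -/
import Mathlib

section
/- Let D be a real symmetric positive definite d×d matrix. Then the function A ↦ trace(A⁻¹ D) is strictly convex on the set of real symmetric positive definite d×d matrices: for all symmetric positive definite A ≠ B and all t ∈ (0,1), trace((t A + (1−t) B)⁻¹ D) < t·trace(A⁻¹ D) + (1−t)·trace(B⁻¹ D). -/
open Matrix

open scoped MatrixOrder Matrix.Norms.L2Operator in
lemma aux_factor {d : ℕ} {A : Matrix (Fin d) (Fin d) ℝ} (hA : A.PosDef) :
    ∃ S : Matrix (Fin d) (Fin d) ℝ, IsUnit S ∧ A = Sᴴ * S :=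
  CStarAlgebra.isStrictlyPositive_iff_eq_star_mul_self.mp hA.isStrictlyPositive

lemma aux_trace_pos {d : ℕ} {A D P : Matrix (Fin d) (Fin d) ℝ} (hA : A.PosDef) (hD : D.PosDef)
    (hP : P.IsHermitian) (h0 : P ≠ 0) : 0 < (P * A * P * D).trace := by
  obtain ⟨S, hS, rfl⟩ := aux_factor hA
  obtain ⟨R, hR, rfl⟩ := aux_factor hD
  have e : (P * (Sᴴ * S) * P * (Rᴴ * R)).trace = ((S * P * Rᴴ)ᴴ * (S * P * Rᴴ)).trace := by
    have h1 : P * (Sᴴ * S) * P * (Rᴴ * R) = (P * Sᴴ * S * P * Rᴴ) * R := by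
      simp only [Matrix.mul_assoc]
    rw [h1, Matrix.trace_mul_comm]
    simp only [Matrix.conjTranspose_mul, Matrix.conjTranspose_conjTranspose, hP.eq,
      Matrix.mul_assoc]
  rw [e]
  refine lt_of_le_of_ne (Matrix.posSemidef_conjTranspose_mul_self _).trace_nonneg fun h => h0 ?_
  have h2 := Matrix.trace_conjTranspose_mul_self_eq_zero_iff.mp h.symm
  have hR' : IsUnit Rᴴ := hR.star
  rwa [hR'.mul_left_eq_zero, hS.mul_right_eq_zero] at h2

/-- For a real symmetric positive definite matrix `D`, the map
`A ↦ trace (A⁻¹ D)` is strictly convex on the set of real symmetric positive definite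
matrices. -/
theorem trace_inv_mul_strictConvex {d : ℕ} {D : Matrix (Fin d) (Fin d) ℝ} (hD : D.PosDef)
    {A B : Matrix (Fin d) (Fin d) ℝ} (hA : A.PosDef) (hB : B.PosDef) (hAB : A ≠ B)
    {t : ℝ} (ht0 : 0 < t) (ht1 : t < 1) :
    ((t • A + (1 - t) • B)⁻¹ * D).trace <
      t * (A⁻¹ * D).trace + (1 - t) * (B⁻¹ * D).trace := by
  have hs : 0 < 1 - t := by linarith
  have hC : (t • A + (1 - t) • B).PosDef := (hA.smul ht0).add (hB.smul hs)
  obtain ⟨C, hCe⟩ : ∃ C, C = t • A + (1 - t) • B := ⟨_, rfl⟩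
  rw [← hCe] at hC ⊢
  have uA := (Matrix.isUnit_iff_isUnit_det _).mp hA.isUnit
  have uB := (Matrix.isUnit_iff_isUnit_det _).mp hB.isUnit
  have uC := (Matrix.isUnit_iff_isUnit_det _).mp hC.isUnit
  have nA : A⁻¹ - C⁻¹ ≠ 0 := by
    intro h
    have h1 : A = C := by
      rw [← Matrix.nonsing_inv_nonsing_inv A uA, sub_eq_zero.mp h,
        Matrix.nonsing_inv_nonsing_inv C uC]
    have h2 : (1 - t) • (A - B) = 0 := by
      have h3 : (1 - t) • (A - B) = A - (t • A + (1 - t) • B) := by module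
      rw [h3, ← hCe, ← h1, sub_self]
    exact hAB (sub_eq_zero.mp ((smul_eq_zero.mp h2).resolve_left hs.ne'))
  have nB : B⁻¹ - C⁻¹ ≠ 0 := by
    intro h
    have h1 : B = C := by
      rw [← Matrix.nonsing_inv_nonsing_inv B uB, sub_eq_zero.mp h,
        Matrix.nonsing_inv_nonsing_inv C uC]
    have h2 : t • (A - B) = 0 := by
      have h3 : t • (A - B) = (t • A + (1 - t) • B) - B := by module
      rw [h3, ← hCe, ← h1, sub_self]
    exact hAB (sub_eq_zero.mp ((smul_eq_zero.mp h2).resolve_left ht0.ne'))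
  have pA := aux_trace_pos hA hD (hA.inv.isHermitian.sub hC.inv.isHermitian) nA
  have pB := aux_trace_pos hB hD (hB.inv.isHermitian.sub hC.inv.isHermitian) nB
  have exp : ∀ X : Matrix (Fin d) (Fin d) ℝ, IsUnit X.det →
      (X⁻¹ - C⁻¹) * X * (X⁻¹ - C⁻¹) = X⁻¹ - (2 : ℝ) • C⁻¹ + C⁻¹ * X * C⁻¹ := by
    intro X hX
    rw [Matrix.sub_mul, Matrix.nonsing_inv_mul X hX, Matrix.sub_mul, Matrix.mul_sub,
      Matrix.mul_sub, Matrix.mul_assoc C⁻¹ X X⁻¹, Matrix.mul_nonsing_inv X hX, Matrix.one_mul,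
      Matrix.one_mul, Matrix.mul_one]
    module
  have hCC : t • (C⁻¹ * A * C⁻¹) + (1 - t) • (C⁻¹ * B * C⁻¹) = C⁻¹ := by
    have h1 : t • (C⁻¹ * A * C⁻¹) + (1 - t) • (C⁻¹ * B * C⁻¹)
        = C⁻¹ * (t • A + (1 - t) • B) * C⁻¹ := by
      simp only [Matrix.mul_add, Matrix.add_mul, Matrix.mul_smul, Matrix.smul_mul]
    rw [h1, ← hCe, Matrix.nonsing_inv_mul C uC, Matrix.one_mul]
  have tr := congrArg (fun M => (M * D).trace) hCC
  simp only [Matrix.add_mul, Matrix.smul_mul, Matrix.trace_add, Matrix.trace_smul,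
    smul_eq_mul] at tr
  rw [exp A uA] at pA
  rw [exp B uB] at pB
  simp only [Matrix.add_mul, Matrix.sub_mul, Matrix.smul_mul, Matrix.trace_add,
    Matrix.trace_sub, Matrix.trace_smul, smul_eq_mul] at pA pB
  have qA := mul_pos ht0 pA
  have qB := mul_pos hs pB
  linarith
end

section
/- Let S and D be real symmetric positive definite d×d matrices, and define h(A) := trace(A S) + trace(A⁻¹ D) on symmetric positive definite matrices A. Then h is strictly convex: for all symmetric positive definite A ≠ B and all t ∈ (0,1), h(t A + (1−t) B) < t·h(A) + (1−t)·h(B). -/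
open Matrix

open scoped MatrixOrder in
lemma posDef_factor {d : ℕ} {A : Matrix (Fin d) (Fin d) ℝ} (hA : A.PosDef) :
    ∃ K : Matrix (Fin d) (Fin d) ℝ, IsUnit K ∧ IsUnit Kᴴ ∧ A = Kᴴ * K := by
  obtain ⟨K, hK⟩ := CStarAlgebra.nonneg_iff_eq_star_mul_self.mp hA.posSemidef.nonneg
  rw [star_eq_conjTranspose] at hK
  have hu : IsUnit (Kᴴ * K) := hK ▸ hA.isUnit
  rw [Matrix.isUnit_iff_isUnit_det, Matrix.det_mul, IsUnit.mul_iff] at hu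
  exact ⟨K, (Matrix.isUnit_iff_isUnit_det _).2 hu.2, (Matrix.isUnit_iff_isUnit_det _).2 hu.1, hK⟩

lemma trace_quad_nonneg {d : ℕ} {A D E : Matrix (Fin d) (Fin d) ℝ} (hA : A.PosDef)
    (hD : D.PosDef) (hE : Eᴴ = E) :
    0 ≤ (E * A * E * D).trace ∧ (E ≠ 0 → 0 < (E * A * E * D).trace) := by
  obtain ⟨K, hK, -, rfl⟩ := posDef_factor hA
  obtain ⟨L, -, hL, rfl⟩ := posDef_factor hD
  have key : (E * (Kᴴ * K) * E * (Lᴴ * L)).trace = ((K * E * Lᴴ)ᴴ * (K * E * Lᴴ)).trace := by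
    simp only [conjTranspose_mul, hE, conjTranspose_conjTranspose]
    rw [← Matrix.mul_assoc, Matrix.trace_mul_comm]
    simp only [Matrix.mul_assoc]
  have h0 := (posSemidef_conjTranspose_mul_self (K * E * Lᴴ)).trace_nonneg
  rw [key]
  refine ⟨h0, fun hne => lt_of_le_of_ne h0 fun h => hne ?_⟩
  have h1 := trace_conjTranspose_mul_self_eq_zero_iff.mp h.symm
  rwa [hL.mul_left_eq_zero, hK.mul_right_eq_zero] at h1

lemma quad_expand {d : ℕ} {A C D : Matrix (Fin d) (Fin d) ℝ} (hA : A.PosDef) :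
    ((A⁻¹ - C⁻¹) * A * (A⁻¹ - C⁻¹) * D).trace
      = (A⁻¹ * D).trace - 2 * (C⁻¹ * D).trace + (C⁻¹ * A * C⁻¹ * D).trace := by
  have hd := (Matrix.isUnit_iff_isUnit_det A).1 hA.isUnit
  have : (A⁻¹ - C⁻¹) * A * (A⁻¹ - C⁻¹) * D
      = A⁻¹ * D - C⁻¹ * D - C⁻¹ * D + C⁻¹ * A * C⁻¹ * D := by
    rw [sub_mul, Matrix.nonsing_inv_mul _ hd, sub_mul, mul_sub, mul_sub, Matrix.mul_assoc C⁻¹ A A⁻¹,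
      Matrix.mul_nonsing_inv _ hd]
    noncomm_ring
  rw [this]
  simp only [trace_add, trace_sub]
  ring

/-- For real symmetric positive definite matrices `S` and `D`, the GMML
cost `h(A) = trace(A S) + trace(A⁻¹ D)` is strictly convex on the set of real symmetric
positive definite matrices. -/
theorem gmml_cost_strictConvex {d : ℕ} {S D : Matrix (Fin d) (Fin d) ℝ}
    (hS : S.PosDef) (hD : D.PosDef)
    (h : Matrix (Fin d) (Fin d) ℝ → ℝ)
    (hdef : ∀ A, h A = (A * S).trace + (A⁻¹ * D).trace)
    {A B : Matrix (Fin d) (Fin d) ℝ} (hA : A.PosDef) (hB : B.PosDef) (hAB : A ≠ B)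
    {t : ℝ} (ht0 : 0 < t) (ht1 : t < 1) :
    h (t • A + (1 - t) • B) < t * h A + (1 - t) * h B := by
  have ht : 0 < 1 - t := by linarith
  have hC : (t • A + (1 - t) • B).PosDef := (hA.smul ht0).add (hB.smul ht)
  have hlin : ((t • A + (1 - t) • B) * S).trace = t * (A * S).trace + (1 - t) * (B * S).trace := by
    simp [add_mul, trace_add, trace_smul]
  rw [hdef, hdef, hdef, hlin]
  obtain ⟨C, hCd⟩ : ∃ C, C = t • A + (1 - t) • B := ⟨_, rfl⟩
  rw [← hCd] at hC ⊢
  have hCu := (Matrix.isUnit_iff_isUnit_det C).1 hC.isUnit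
  have hAu := (Matrix.isUnit_iff_isUnit_det A).1 hA.isUnit
  have hs : ∀ {X : Matrix (Fin d) (Fin d) ℝ}, X.PosDef → (X⁻¹ - C⁻¹)ᴴ = X⁻¹ - C⁻¹ :=
    fun hX => hX.inv.isHermitian.sub hC.inv.isHermitian
  have hne : A⁻¹ - C⁻¹ ≠ 0 := by
    intro h0
    have hAC : A = C := by
      rw [← Matrix.nonsing_inv_nonsing_inv A hAu, sub_eq_zero.mp h0,
        Matrix.nonsing_inv_nonsing_inv C hCu]
    apply hAB
    have h2 : (1 - t) • (A - B) = 0 := by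
      have : (1 - t) • (A - B) = A - (t • A + (1 - t) • B) := by module
      rw [this, ← hCd, ← hAC, sub_self]
    exact sub_eq_zero.mp ((smul_eq_zero.mp h2).resolve_left ht.ne')
  have hP := (trace_quad_nonneg hA hD (hs hA)).2 hne
  have hQ := (trace_quad_nonneg hB hD (hs hB)).1
  rw [quad_expand hA] at hP
  rw [quad_expand hB] at hQ
  have hmix : t * (C⁻¹ * A * C⁻¹ * D).trace + (1 - t) * (C⁻¹ * B * C⁻¹ * D).trace
      = (C⁻¹ * D).trace := by
    have : C⁻¹ * D = C⁻¹ * (t • A + (1 - t) • B) * C⁻¹ * D := by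
      rw [← hCd, Matrix.nonsing_inv_mul _ hCu, one_mul]
    conv_rhs => rw [this]
    simp [add_mul, mul_add, trace_add, trace_smul]
  have := mul_pos ht0 hP
  have := mul_nonneg ht.le hQ
  linarith
end
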